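/- arXiv:1106.5960 — 2 statements merged into one kernel-verified Lean document; each statement's English description precedes it below -/
import Mathlib

section
/- Let C be a binary [n, n/2] code with an automorphism σ of odd prime order p of type p-(c,f). Then C is self-dual if and only if both of the following hold: (i) C_π = π(F_σ(C)) is a binary self-dual code of length c+f; (ii) for every two vectors u = (u_1,…,u_c) and v = (v_1,…,v_c) of C_φ = φ(E_σ(C)*), one has u_1(x)v_1(x^{−1}) + u_2(x)v_2(x^{−1}) + ⋯ + u_c(x)v_c(x^{−1}) = 0 in R_p = F_2[x]/⟨x^p − 1⟩. -/
namespace SD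

variable {ι : Type*}

/-- The (Hamming) weight of a binary vector. -/
def wt [Fintype ι] (v : ι → ZMod 2) : ℕ := (Finset.univ.filter fun i => v i ≠ 0).card

/-- A binary code (subspace of `F_2^ι`) is self-dual if it coincides with its dual
under the standard inner product. -/
def isSelfDual [Fintype ι] (Code : Submodule (ZMod 2) (ι → ZMod 2)) : Prop :=
  ∀ u : ι → ZMod 2, u ∈ Code ↔ ∀ v ∈ Code, ∑ i, u i * v i = 0

/-- The linear map permuting coordinates of vectors by `σ`. -/
def permLM (σ : Equiv.Perm ι) : (ι → ZMod 2) →ₗ[ZMod 2] (ι → ZMod 2) where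
  toFun v := v ∘ σ
  map_add' _ _ := rfl
  map_smul' _ _ := rfl

/-- The image of a code under a coordinate permutation. -/
def permCode (σ : Equiv.Perm ι) (Code : Submodule (ZMod 2) (ι → ZMod 2)) :
    Submodule (ZMod 2) (ι → ZMod 2) := Submodule.map (permLM σ) Code

/-- Two binary codes are equivalent if a coordinate permutation maps one onto the other. -/
def codeEquiv (C D : Submodule (ZMod 2) (ι → ZMod 2)) : Prop :=
  ∃ σ : Equiv.Perm ι, permCode σ C = D

/-- The code has minimum weight (exactly) `d`. -/
def minWtEq [Fintype ι] (Code : Submodule (ZMod 2) (ι → ZMod 2)) (d : ℕ) : Prop :=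
  (∀ v ∈ Code, v ≠ 0 → d ≤ wt v) ∧ ∃ v ∈ Code, v ≠ 0 ∧ wt v = d

/-- Coordinates for a length `p*c + f` code: `c` blocks of size `p` (the `p`-cycles)
together with `f` fixed points. -/
abbrev Idx (p c f : ℕ) := Fin c × Fin p ⊕ Fin f

/-- The standard automorphism of type `p-(c,f)`: a simultaneous cyclic shift in each
of the `c` blocks of length `p`, fixing the `f` fixed points. -/
def stdPerm (p c f : ℕ) [NeZero p] : Equiv.Perm (Idx p c f) :=
  Equiv.sumCongr ((Equiv.refl (Fin c)).prodCongr (Equiv.addRight (1 : Fin p))) (Equiv.refl (Fin f))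

/-- `F_σ(C)`: the subcode of codewords fixed by the standard automorphism. -/
def fixedSubcode (p c f : ℕ) [NeZero p] (Code : Submodule (ZMod 2) (Idx p c f → ZMod 2)) :
    Submodule (ZMod 2) (Idx p c f → ZMod 2) :=
  Code ⊓ LinearMap.ker (permLM (stdPerm p c f) - LinearMap.id)

/-- The linear functional summing the coordinates of a vector over the `b`-th cycle. -/
def cycleSum (p c f : ℕ) (b : Fin c) : (Idx p c f → ZMod 2) →ₗ[ZMod 2] ZMod 2 where
  toFun v := ∑ r : Fin p, v (Sum.inl (b, r))
  map_add' u v := by simp [Finset.sum_add_distrib]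
  map_smul' a v := by simp [Finset.mul_sum]

/-- `E_σ(C)`: the subcode of codewords whose restriction to every cycle and every fixed
point has even weight (over `F_2`: sums to zero). -/
def evenSubcode (p c f : ℕ) [NeZero p] (Code : Submodule (ZMod 2) (Idx p c f → ZMod 2)) :
    Submodule (ZMod 2) (Idx p c f → ZMod 2) :=
  Code ⊓ (⨅ b : Fin c, LinearMap.ker (cycleSum p c f b)) ⊓
    (⨅ k : Fin f, LinearMap.ker (LinearMap.proj (R := ZMod 2) (φ := fun _ : Idx p c f => ZMod 2) (Sum.inr k)))

/-- The projection `π : F_σ(C) → F_2^{c+f}` reading off the common value on each cycle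
and the value at each fixed point. -/
def piLM (p c f : ℕ) [NeZero p] : (Idx p c f → ZMod 2) →ₗ[ZMod 2] ((Fin c ⊕ Fin f) → ZMod 2) where
  toFun v := Sum.elim (fun b => v (Sum.inl (b, 0))) fun k => v (Sum.inr k)
  map_add' u v := by funext x; cases x <;> rfl
  map_smul' a v := by funext x; cases x <;> rfl

/-- `R_p = F_2[x]/(x^p - 1)`. -/
def Rp (p : ℕ) : Type := Polynomial (ZMod 2) ⧸ Ideal.span {(Polynomial.X : Polynomial (ZMod 2)) ^ p - 1}

noncomputable instance (p : ℕ) : CommRing (Rp p) := Ideal.Quotient.commRing _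

/-- The natural projection `F_2[x] → R_p`. -/
noncomputable def toRp (p : ℕ) (q : Polynomial (ZMod 2)) : Rp p := Ideal.Quotient.mk _ q

/-- `φ` coordinatewise: the `b`-th cycle of `v` viewed as an element of `R_p`. -/
noncomputable def phiCoord (p c f : ℕ) (v : Idx p c f → ZMod 2) (b : Fin c) : Rp p :=
  toRp p (∑ r : Fin p, Polynomial.C (v (Sum.inl (b, r))) * Polynomial.X ^ (r : ℕ))

/-- The `b`-th cycle of `v` viewed as a polynomial in `x⁻¹` (using `x⁻¹ = x^{p-1}` in `R_p`). -/
noncomputable def phiCoordInv (p c f : ℕ) (v : Idx p c f → ZMod 2) (b : Fin c) : Rp p :=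
  toRp p (∑ r : Fin p, Polynomial.C (v (Sum.inl (b, r))) * Polynomial.X ^ ((p - 1) * (r : ℕ)))

/-- `P`: the set of even-weight polynomials in `R_p`. -/
def Pset (p : ℕ) : Set (Rp p) :=
  {a | ∃ w : Fin p → ZMod 2,
    a = toRp p (∑ r : Fin p, Polynomial.C (w r) * Polynomial.X ^ (r : ℕ)) ∧ ∑ r, w r = 0}

/-- `C_φ = φ(E_σ(C)^*)` as a subset of `R_p^c`. -/
def CphiSet (p c f : ℕ) [NeZero p] (Code : Submodule (ZMod 2) (Idx p c f → ZMod 2)) :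
    Set (Fin c → Rp p) :=
  {u | ∃ v ∈ evenSubcode p c f Code, ∀ b, u b = phiCoord p c f v b}

/-- An automorphism of type `p-(c,f)` of a code of length `n`: order `p`, exactly `f`
fixed points (hence exactly `c` independent `p`-cycles, as `n = p*c + f`). -/
def autOfType {n : ℕ} (σ : Equiv.Perm (Fin n)) (p c f : ℕ) : Prop :=
  orderOf σ = p ∧ (Finset.univ.filter fun i => σ i = i).card = f ∧ n = p * c + f

/-- The simultaneous cyclic shift by `s` in every block. -/
def shift (p c f : ℕ) [NeZero p] (s : Fin p) (v : Idx p c f → ZMod 2) : Idx p c f → ZMod 2 :=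
  Sum.elim (fun x => v (Sum.inl (x.1, x.2 + s))) fun k => v (Sum.inr k)

/-- The sum of all cyclic shifts of a vector, when `p` is odd. -/
def orbitSum (p c f : ℕ) (v : Idx p c f → ZMod 2) : Idx p c f → ZMod 2 :=
  Sum.elim (fun x => ∑ s : Fin p, v (Sum.inl (x.1, s))) fun k => v (Sum.inr k)

/-- The vector which is constant on each cycle with values prescribed by `w`. -/
def constLift (p c f : ℕ) (w : Fin c ⊕ Fin f → ZMod 2) : Idx p c f → ZMod 2 :=
  Sum.elim (fun x => w (Sum.inl x.1)) fun k => w (Sum.inr k)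

theorem constLift_dot_constLift {p c f : ℕ} (hodd : Odd p) (w w' : Fin c ⊕ Fin f → ZMod 2) :
    ∑ i, constLift p c f w i * constLift p c f w' i = ∑ i, w i * w' i := by
  have hp1 : (p : ZMod 2) = 1 := (ZMod.natCast_eq_one_iff_odd).2 hodd
  simp [Fintype.sum_sum_type, Fintype.sum_prod_type, constLift, hp1]

section

variable {p c f : ℕ} [NeZero p] {Code : Submodule (ZMod 2) (Idx p c f → ZMod 2)}

theorem shift_mem_of_permCode_eq (haut : permCode (stdPerm p c f) Code = Code) (s : Fin p)
    {v : Idx p c f → ZMod 2} (hv : v ∈ Code) : shift p c f s v ∈ Code := by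
  have key : ∀ n : ℕ, shift p c f (Fin.ofNat p n) v ∈ Code := by
    intro n
    induction n with
    | zero =>
      convert hv using 1
      funext x
      rcases x with ⟨b, r⟩ | k <;> simp [shift]
    | succ n ih =>
      rw [← haut]
      refine Submodule.mem_map.mpr ⟨_, ih, ?_⟩
      funext x
      rcases x with ⟨b, r⟩ | k
      · have h : Fin.ofNat p (n + 1) = 1 + Fin.ofNat p n := by
          apply Fin.ext
          simp [Fin.val_add, add_comm]
        simp only [shift, h]
        simp [permLM, stdPerm, add_assoc]
      · simp [shift, permLM, stdPerm]
  simpa using key s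

theorem orbitSum_eq_sum_shift (hodd : Odd p) (v : Idx p c f → ZMod 2) :
    orbitSum p c f v = ∑ s : Fin p, shift p c f s v := by
  have hp1 : (p : ZMod 2) = 1 := (ZMod.natCast_eq_one_iff_odd).2 hodd
  funext x
  rcases x with ⟨b, r⟩ | k
  · simp only [orbitSum, shift, Finset.sum_apply, Sum.elim_inl]
    exact (Equiv.sum_comp (Equiv.addLeft r) fun s => v (Sum.inl (b, s))).symm
  · simp [orbitSum, shift, Finset.sum_apply, hp1]

theorem mem_fixedSubcode_iff {v : Idx p c f → ZMod 2} :
    v ∈ fixedSubcode p c f Code ↔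
      v ∈ Code ∧ ∀ b r, v (Sum.inl (b, r + 1)) = v (Sum.inl (b, r)) := by
  simp only [fixedSubcode, Submodule.mem_inf, LinearMap.mem_ker, LinearMap.sub_apply,
    LinearMap.id_apply, sub_eq_zero]
  refine and_congr_right fun _ => ⟨fun h b r => ?_, fun h => ?_⟩
  · simpa [permLM, stdPerm] using congrFun h (Sum.inl (b, r))
  · funext x
    rcases x with ⟨b, r⟩ | k
    · simpa [permLM, stdPerm] using h b r
    · simp [permLM, stdPerm]

theorem mem_evenSubcode_iff {v : Idx p c f → ZMod 2} :
    v ∈ evenSubcode p c f Code ↔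
      v ∈ Code ∧ (∀ b, ∑ r : Fin p, v (Sum.inl (b, r)) = 0) ∧ ∀ k, v (Sum.inr k) = 0 := by
  simp [evenSubcode, cycleSum, Submodule.mem_iInf, and_assoc]

theorem eq_constLift_piLM {v : Idx p c f → ZMod 2} (hv : v ∈ fixedSubcode p c f Code) :
    v = constLift p c f (piLM p c f v) := by
  have h := (mem_fixedSubcode_iff.1 hv).2
  have key : ∀ b, ∀ n : ℕ, v (Sum.inl (b, Fin.ofNat p n)) = v (Sum.inl (b, 0)) := by
    intro b n
    induction n with
    | zero => simp
    | succ n ih =>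
      have hn : Fin.ofNat p (n + 1) = Fin.ofNat p n + 1 := by
        apply Fin.ext
        simp [Fin.val_add]
      rw [hn, h, ih]
  funext x
  rcases x with ⟨b, r⟩ | k
  · simpa [constLift, piLM] using key b r
  · simp [constLift, piLM]

theorem piLM_constLift (w : Fin c ⊕ Fin f → ZMod 2) : piLM p c f (constLift p c f w) = w := by
  funext x
  rcases x with b | k <;> simp [constLift, piLM]

theorem orbitSum_mem_fixedSubcode (hodd : Odd p) (haut : permCode (stdPerm p c f) Code = Code)
    {v : Idx p c f → ZMod 2} (hv : v ∈ Code) : orbitSum p c f v ∈ fixedSubcode p c f Code := by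
  refine mem_fixedSubcode_iff.2 ⟨?_, fun b r => by simp [orbitSum]⟩
  rw [orbitSum_eq_sum_shift hodd]
  exact Submodule.sum_mem _ fun s _ => shift_mem_of_permCode_eq haut s hv

theorem sub_orbitSum_mem_evenSubcode (hodd : Odd p)
    (haut : permCode (stdPerm p c f) Code = Code) {v : Idx p c f → ZMod 2} (hv : v ∈ Code) :
    v - orbitSum p c f v ∈ evenSubcode p c f Code := by
  have hp1 : (p : ZMod 2) = 1 := (ZMod.natCast_eq_one_iff_odd).2 hodd
  refine mem_evenSubcode_iff.2 ⟨Code.sub_mem hv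
    (mem_fixedSubcode_iff.1 (orbitSum_mem_fixedSubcode hodd haut hv)).1, fun b => ?_, fun k => ?_⟩
  · simp [orbitSum, hp1]
  · simp [orbitSum]

theorem constLift_dot_even {v : Idx p c f → ZMod 2} (hv : v ∈ evenSubcode p c f Code)
    (w : Fin c ⊕ Fin f → ZMod 2) : ∑ i, constLift p c f w i * v i = 0 := by
  obtain ⟨-, hb, hk⟩ := mem_evenSubcode_iff.1 hv
  simp [Fintype.sum_sum_type, Fintype.sum_prod_type, constLift, ← Finset.mul_sum, hb, hk]

end

/-- `toRp` as a ring homomorphism. -/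
noncomputable def toRpHom (p : ℕ) : Polynomial (ZMod 2) →+* Rp p := Ideal.Quotient.mk _

theorem toRp_sum_eq_zero_iff {p : ℕ} [NeZero p] (a : Fin p → ZMod 2) :
    toRp p (∑ j : Fin p, Polynomial.C (a j) * Polynomial.X ^ (j : ℕ)) = 0 ↔ ∀ j, a j = 0 := by
  constructor
  · intro h
    have hdvd : (Polynomial.X : Polynomial (ZMod 2)) ^ p - 1 ∣
        ∑ j : Fin p, Polynomial.C (a j) * Polynomial.X ^ (j : ℕ) :=
      Ideal.mem_span_singleton.1 (Ideal.Quotient.eq_zero_iff_mem.1 h)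
    have hzero := Polynomial.eq_zero_of_dvd_of_degree_lt hdvd (by
      rw [← Polynomial.C_1, Polynomial.degree_X_pow_sub_C (NeZero.pos p)]
      exact Polynomial.degree_sum_fin_lt a)
    intro j
    have := congrArg (fun q => Polynomial.coeff q (j : ℕ)) hzero
    simpa [Polynomial.finsetSum_coeff, Polynomial.coeff_X_pow, Fin.val_inj] using this
  · intro h
    change toRpHom p _ = 0
    simp [h]

theorem toRpHom_X_pow (p : ℕ) : toRpHom p Polynomial.X ^ p = 1 := by
  rw [← map_pow, ← sub_eq_zero, ← map_one (toRpHom p), ← map_sub]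
  exact Ideal.Quotient.eq_zero_iff_mem.2 (Ideal.mem_span_singleton_self _)

/-- Multiplication of `a(x)` by `b(x⁻¹)` when `x ^ p = 1`: the coefficients are the cyclic
correlations of `a` and `b`. -/
theorem sum_mul_sum_inv_pow {R : Type*} [CommRing R] {p : ℕ} [NeZero p] {x : R} (hx : x ^ p = 1)
    (a b : Fin p → R) :
    (∑ r, a r * x ^ (r : ℕ)) * ∑ s, b s * x ^ ((p - 1) * (s : ℕ)) =
      ∑ j : Fin p, (∑ s, a (s + j) * b s) * x ^ (j : ℕ) := by
  have hpow (s j : Fin p) : x ^ ((s + j : Fin p) : ℕ) * x ^ ((p - 1) * (s : ℕ)) = x ^ (j : ℕ) := by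
    have hexp : (s + j : ℕ) + (p - 1) * s = p * s + j := by
      have h : p * (s : ℕ) = (p - 1) * s + s := by
        rw [← Nat.succ_mul, Nat.succ_eq_add_one, Nat.sub_add_cancel (NeZero.pos p)]
      omega
    rw [Fin.val_add, ← pow_eq_pow_mod _ hx, ← pow_add, hexp, pow_add, pow_mul, hx, one_pow,
      one_mul]
  simp_rw [Finset.sum_mul_sum, Finset.sum_mul]
  rw [Finset.sum_comm, Finset.sum_comm (f := fun j s => _ * x ^ ((j : Fin p) : ℕ))]
  refine Finset.sum_congr rfl fun s _ => ?_
  rw [← Equiv.sum_comp (Equiv.addLeft s)]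
  refine Finset.sum_congr rfl fun j _ => ?_
  rw [← hpow s j]
  simp only [Equiv.coe_addLeft]
  ring

section

variable {p c f : ℕ} [NeZero p] {Code : Submodule (ZMod 2) (Idx p c f → ZMod 2)}

theorem sum_phiCoord_mul_phiCoordInv (u v : Idx p c f → ZMod 2) :
    ∑ b : Fin c, phiCoord p c f u b * phiCoordInv p c f v b =
      toRp p (∑ j : Fin p, Polynomial.C
        (∑ b : Fin c, ∑ s : Fin p, u (Sum.inl (b, s + j)) * v (Sum.inl (b, s))) *
          Polynomial.X ^ (j : ℕ)) := by
  change ∑ b : Fin c, toRpHom p _ * toRpHom p _ = toRpHom p _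
  simp only [map_sum, map_mul, map_pow]
  refine (Finset.sum_congr rfl fun b _ => sum_mul_sum_inv_pow (toRpHom_X_pow p) _ _).trans ?_
  rw [Finset.sum_comm]
  refine Finset.sum_congr rfl fun j _ => ?_
  exact (Finset.sum_mul _ _ _).symm

theorem sum_phiCoord_mul_phiCoordInv_eq_zero_iff {u v : Idx p c f → ZMod 2}
    (hv : v ∈ evenSubcode p c f Code) :
    ∑ b : Fin c, phiCoord p c f u b * phiCoordInv p c f v b = 0 ↔
      ∀ j, ∑ i, shift p c f j u i * v i = 0 := by
  rw [sum_phiCoord_mul_phiCoordInv, toRp_sum_eq_zero_iff]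
  simp [Fintype.sum_sum_type, Fintype.sum_prod_type, shift, (mem_evenSubcode_iff.1 hv).2.2]

end

/-- A self-orthogonal code of half the length is self-dual. -/
theorem isSelfDual_of_dot_eq_zero {ι : Type*} [Fintype ι]
    {Code : Submodule (ZMod 2) (ι → ZMod 2)}
    (hdim : 2 * Module.finrank (ZMod 2) Code = Fintype.card ι)
    (horth : ∀ u ∈ Code, ∀ v ∈ Code, ∑ i, u i * v i = 0) : isSelfDual Code := by
  classical
  let B : LinearMap.BilinForm (ZMod 2) (ι → ZMod 2) := Matrix.toBilin' 1
  have hB : ∀ u v, B u v = ∑ i, u i * v i := fun u v => by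
    simp [B, Matrix.toBilin'_apply', dotProduct]
  have hnd : B.Nondegenerate := Matrix.Nondegenerate.toBilin' (by
    exact Matrix.nondegenerate_of_det_ne_zero (by simp))
  have hle : Code ≤ B.orthogonal Code := fun u hu v hv => by
    change B v u = 0
    rw [hB]
    exact horth v hv u hu
  have heq : Code = B.orthogonal Code := by
    refine Submodule.eq_of_le_of_finrank_eq hle ?_
    rw [LinearMap.BilinForm.finrank_orthogonal hnd, Module.finrank_fintype_fun_eq_card]
    omega
  intro u
  refine ⟨fun hu v hv => horth u hu v hv, fun h => ?_⟩
  rw [heq]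
  intro v hv
  change B v u = 0
  rw [hB]
  simpa [mul_comm] using h v hv

/-- A binary `[n, n/2]` code with the standard automorphism of odd prime order `p` of
type `p-(c,f)` is self-dual iff (i) `C_π = π(F_σ(C))` is a self-dual binary code of
length `c + f`, and (ii) any two vectors `u, v` of `C_φ = φ(E_σ(C)^*)` satisfy
`u₁(x)v₁(x⁻¹) + ⋯ + u_c(x)v_c(x⁻¹) = 0` in `R_p = F_2[x]/⟨x^p - 1⟩`
(where `x⁻¹ = x^{p-1}`). -/
theorem sd_iff_pi_selfdual_and_phi_orthogonal (p c f : ℕ) [NeZero p]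
    (hp : p.Prime) (hodd : Odd p)
    (Code : Submodule (ZMod 2) (Idx p c f → ZMod 2))
    (hdim : 2 * Module.finrank (ZMod 2) Code = p * c + f)
    (haut : permCode (stdPerm p c f) Code = Code) :
    isSelfDual Code ↔
      (isSelfDual (Submodule.map (piLM p c f) (fixedSubcode p c f Code)) ∧
       ∀ u ∈ evenSubcode p c f Code, ∀ v ∈ evenSubcode p c f Code,
         ∑ b : Fin c, phiCoord p c f u b * phiCoordInv p c f v b = 0) := by
  constructor
  · intro hsd
    refine ⟨fun w => ⟨?_, fun hw => ?_⟩, fun u hu v hv => ?_⟩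
    · rintro ⟨x, hx, rfl⟩ _ ⟨y, hy, rfl⟩
      rw [← constLift_dot_constLift (p := p) hodd, ← eq_constLift_piLM hx, ← eq_constLift_piLM hy]
      exact (hsd x).1 (mem_fixedSubcode_iff.1 hx).1 y (mem_fixedSubcode_iff.1 hy).1
    · refine ⟨constLift p c f w, mem_fixedSubcode_iff.2 ⟨(hsd _).2 fun v hv => ?_, ?_⟩,
        piLM_constLift w⟩
      · have hF := orbitSum_mem_fixedSubcode hodd haut hv
        have hE := constLift_dot_even (sub_orbitSum_mem_evenSubcode hodd haut hv) w
        have hFw := hw _ (Submodule.mem_map_of_mem hF)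
        rw [← constLift_dot_constLift (p := p) hodd, ← eq_constLift_piLM hF] at hFw
        simpa [mul_sub, hFw] using hE
      · simp [constLift]
    · refine (sum_phiCoord_mul_phiCoordInv_eq_zero_iff hv).2 fun j => ?_
      exact (hsd _).1 (shift_mem_of_permCode_eq haut j (mem_evenSubcode_iff.1 hu).1) v
        (mem_evenSubcode_iff.1 hv).1
  · rintro ⟨hpi, hphi⟩
    refine isSelfDual_of_dot_eq_zero (by simp [hdim, mul_comm]) fun u hu v hv => ?_
    have hFu := orbitSum_mem_fixedSubcode hodd haut hu
    have hFv := orbitSum_mem_fixedSubcode hodd haut hv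
    have hEu := sub_orbitSum_mem_evenSubcode hodd haut hu
    have hEv := sub_orbitSum_mem_evenSubcode hodd haut hv
    have hFF := (hpi _).1 (Submodule.mem_map_of_mem hFu) _ (Submodule.mem_map_of_mem hFv)
    rw [← constLift_dot_constLift (p := p) hodd, ← eq_constLift_piLM hFu,
      ← eq_constLift_piLM hFv] at hFF
    have hFE := constLift_dot_even hEv (piLM p c f (orbitSum p c f u))
    rw [← eq_constLift_piLM hFu] at hFE
    have hEF := constLift_dot_even hEu (piLM p c f (orbitSum p c f v))
    rw [← eq_constLift_piLM hFv] at hEF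
    have hEE := (sum_phiCoord_mul_phiCoordInv_eq_zero_iff hEv).1 (hphi _ hEu _ hEv) 0
    have hshift : ∀ w : Idx p c f → ZMod 2, shift p c f 0 w = w := fun w => by
      funext x
      rcases x with ⟨b, r⟩ | k <;> simp [shift]
    rw [hshift] at hEE
    have hsplit : ∑ i, u i * v i =
        ∑ i, orbitSum p c f u i * orbitSum p c f v i +
        ∑ i, orbitSum p c f u i * (v - orbitSum p c f v) i +
        ∑ i, orbitSum p c f v i * (u - orbitSum p c f u) i +
        ∑ i, (u - orbitSum p c f u) i * (v - orbitSum p c f v) i := by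
      simp only [← Finset.sum_add_distrib, Pi.sub_apply]
      exact Finset.sum_congr rfl fun i _ => by ring
    rw [hsplit, hFF, hFE, hEF, hEE]
    simp

end SD
end

section
/- Let C be a binary code of length n with an automorphism σ of odd prime order p of type p-(c,f), and write x^p − 1 = (x−1)h_1(x)⋯h_s(x) with h_1,…,h_s irreducible over F_2; let g_j(x) = (x^p−1)/h_j(x) and let I_j = ⟨g_j(x)⟩ be the ideal of R_p = F_2[x]/⟨x^p−1⟩ generated by g_j(x), so that each I_j is a field with 2^{deg h_j} elements. For j = 1,…,s, set M_j = {u ∈ φ(E_σ(C)*) : u_i ∈ I_j for i = 1,…,c}. Then: (1) each M_j is a linear space over the field I_j; (2) C_φ = φ(E_σ(C)*) is the direct sum M_1 ⊕ M_2 ⊕ ⋯ ⊕ M_s; and (3) if C is self-dual, then Σ_{j=1}^{s} dim_{I_j} M_j = cs/2. -/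
namespace SD

variable {ι : Type*}

/-- The ideal `I = ⟨g(x)⟩` of `R_p`, viewed as a set. -/
def Isub (p : ℕ) (g : Polynomial (ZMod 2)) : Set (Rp p) :=
  (Ideal.span {toRp p g} : Ideal (Rp p))

/-- `M_j = {u ∈ C_φ : every coordinate of u lies in I_j}`. -/
def Msub (p c f : ℕ) [NeZero p] (Code : Submodule (ZMod 2) (Idx p c f → ZMod 2))
    (g : Polynomial (ZMod 2)) : Set (Fin c → Rp p) :=
  {u | u ∈ CphiSet p c f Code ∧ ∀ i, u i ∈ Isub p g}

section Averaging

variable {p c f : ℕ} [NeZero p] {Code : Submodule (ZMod 2) (Idx p c f → ZMod 2)}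

lemma mem_evenSubcode {v : Idx p c f → ZMod 2} :
    v ∈ evenSubcode p c f Code ↔
      v ∈ Code ∧ (∀ b, ∑ r, v (Sum.inl (b, r)) = 0) ∧ ∀ k, v (Sum.inr k) = 0 := by
  simp [evenSubcode, cycleSum, and_assoc]

lemma comp_stdPerm_mem (haut : permCode (stdPerm p c f) Code = Code)
    {v : Idx p c f → ZMod 2} (hv : v ∈ Code) : v ∘ stdPerm p c f ∈ Code := by
  rw [← haut]
  exact ⟨v, hv, rfl⟩

lemma comp_stdPerm_symm_mem (haut : permCode (stdPerm p c f) Code = Code)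
    {v : Idx p c f → ZMod 2} (hv : v ∈ Code) : v ∘ (stdPerm p c f).symm ∈ Code := by
  rw [← haut] at hv
  obtain ⟨w, hw, rfl⟩ := hv
  have : (w ∘ stdPerm p c f) ∘ (stdPerm p c f).symm = w := by
    ext x
    simp
  simpa [permLM, this] using! hw

/-- The vectors that are constant on each cycle, parametrized by their common values. -/
def constLM (p c f : ℕ) : ((Fin c ⊕ Fin f) → ZMod 2) →ₗ[ZMod 2] (Idx p c f → ZMod 2) where
  toFun w := Sum.elim (fun x => w (Sum.inl x.1)) fun k => w (Sum.inr k)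
  map_add' u v := by funext x; cases x <;> rfl
  map_smul' a v := by funext x; cases x <;> rfl

lemma constLM_injective : Function.Injective (constLM p c f) := by
  intro u v huv
  ext (b | k)
  · exact congrFun huv (Sum.inl (b, 0))
  · exact congrFun huv (Sum.inr k)

/-- The cycle sums of a vector, together with its values at the fixed points. -/
def cycleSums (v : Idx p c f → ZMod 2) : (Fin c ⊕ Fin f) → ZMod 2 :=
  Sum.elim (fun b => ∑ r, v (Sum.inl (b, r))) fun k => v (Sum.inr k)

lemma comp_shift_mem (haut : permCode (stdPerm p c f) Code = Code)
    {v : Idx p c f → ZMod 2} (hv : v ∈ Code) (n : ℕ) :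
    (Sum.elim (fun x => v (Sum.inl (x.1, x.2 + Fin.ofNat p n))) fun k => v (Sum.inr k)) ∈ Code := by
  induction n with
  | zero =>
    convert hv using 1
    ext (⟨b, r⟩ | k) <;> simp
  | succ n ih =>
    convert comp_stdPerm_mem haut ih using 1
    ext (⟨b, r⟩ | k)
    · have : r + Fin.ofNat p (n + 1) = r + 1 + Fin.ofNat p n := by
        apply Fin.ext
        simp [Fin.val_add, Nat.add_assoc, Nat.add_comm 1 n]
      simpa [stdPerm] using congrArg (fun x => v (Sum.inl (b, x))) this
    · simp [stdPerm]

lemma constLM_cycleSums_mem (hodd : Odd p) (haut : permCode (stdPerm p c f) Code = Code)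
    {v : Idx p c f → ZMod 2} (hv : v ∈ Code) : constLM p c f (cycleSums v) ∈ Code := by
  have hmem := Code.sum_mem fun (i : Fin p) (_ : i ∈ Finset.univ) =>
    comp_shift_mem haut hv (i : ℕ)
  convert hmem using 1
  ext (⟨b, r⟩ | k)
  · simpa [constLM, cycleSums, Finset.sum_apply] using
      (Equiv.sum_comp (Equiv.addLeft r) fun r => v (Sum.inl (b, r))).symm
  · have : (p : ZMod 2) = 1 := (ZMod.natCast_eq_one_iff_odd).2 hodd
    simp [constLM, cycleSums, Finset.sum_apply, this]

omit [NeZero p] in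
lemma sub_constLM_cycleSums_even (hodd : Odd p) (v : Idx p c f → ZMod 2) :
    (∀ b, ∑ r, (v - constLM p c f (cycleSums v)) (Sum.inl (b, r)) = 0) ∧
      ∀ k, (v - constLM p c f (cycleSums v)) (Sum.inr k) = 0 := by
  have : (p : ZMod 2) = 1 := (ZMod.natCast_eq_one_iff_odd).2 hodd
  constructor <;> intro b <;> simp [constLM, cycleSums, this]

omit [NeZero p] in
lemma constLM_dotProduct_eq_zero {v : Idx p c f → ZMod 2}
    (hv : (∀ b, ∑ r, v (Sum.inl (b, r)) = 0) ∧ ∀ k, v (Sum.inr k) = 0)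
    (w : (Fin c ⊕ Fin f) → ZMod 2) : constLM p c f w ⬝ᵥ v = 0 := by
  simp [dotProduct, constLM, Fintype.sum_prod_type, ← Finset.mul_sum, hv.1, hv.2]

lemma two_mul_finrank_evenSubcode (hodd : Odd p) (haut : permCode (stdPerm p c f) Code = Code)
    (hsd : isSelfDual Code) :
    2 * Module.finrank (ZMod 2) (evenSubcode p c f Code) = c * (p - 1) := by
  set W := evenSubcode p c f Code with hW
  let B : LinearMap.BilinForm (ZMod 2) (Idx p c f → ZMod 2) := dotProductBilin (ZMod 2) (ZMod 2)
  have hker : B.ker = ⊥ := by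
    rw [LinearMap.ker_eq_bot']
    intro v hv
    exact dotProduct_eq_zero v fun w => LinearMap.congr_fun hv w
  have horth : B.orthogonal W = W ⊔ LinearMap.range (constLM p c f) := by
    apply le_antisymm
    · intro u hu
      have hE := sub_constLM_cycleSums_even hodd u
      have hmem : u - constLM p c f (cycleSums u) ∈ W := by
        refine mem_evenSubcode.2 ⟨(hsd _).2 fun v hv => ?_, hE⟩
        have hvE := sub_constLM_cycleSums_even hodd v
        have hvW : v - constLM p c f (cycleSums v) ∈ W :=
          mem_evenSubcode.2 ⟨Code.sub_mem hv (constLM_cycleSums_mem hodd haut hv), hvE⟩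
        have h1 : (v - constLM p c f (cycleSums v)) ⬝ᵥ u = 0 := hu _ hvW
        have h2 := constLM_dotProduct_eq_zero hE (cycleSums v)
        have h3 := constLM_dotProduct_eq_zero hvE (cycleSums u)
        change (u - constLM p c f (cycleSums u)) ⬝ᵥ v = 0
        rw [dotProduct_comm] at h2
        rw [dotProduct_comm] at h1
        rw [dotProduct_sub] at h1 h3
        rw [sub_dotProduct] at h2 ⊢
        linear_combination h1 + h2 - h3
      rw [← sub_add_cancel u (constLM p c f (cycleSums u))]
      exact Submodule.add_mem_sup hmem ⟨_, rfl⟩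
    · refine sup_le (fun u hu v hv => ?_) ?_
      · exact (hsd v).1 (mem_evenSubcode.1 hv).1 u (mem_evenSubcode.1 hu).1
      · rintro _ ⟨w, rfl⟩ v hv
        change v ⬝ᵥ _ = 0
        rw [dotProduct_comm]
        exact constLM_dotProduct_eq_zero (mem_evenSubcode.1 hv).2 w
  have hdisj : W ⊓ LinearMap.range (constLM p c f) = ⊥ := by
    rw [eq_bot_iff]
    rintro _ ⟨hw, w, rfl⟩
    have hw := (mem_evenSubcode.1 hw).2
    have : (p : ZMod 2) = 1 := (ZMod.natCast_eq_one_iff_odd).2 hodd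
    have hw0 : w = 0 := by
      ext (b | k)
      · simpa [constLM, this] using hw.1 b
      · simpa [constLM] using hw.2 k
    simp [hw0]
  have hrange : Module.finrank (ZMod 2) (LinearMap.range (constLM p c f)) = c + f := by
    rw [LinearMap.finrank_range_of_inj constLM_injective]
    simp
  have hsum := Submodule.finrank_sup_add_finrank_inf_eq W (LinearMap.range (constLM p c f))
  have htot := B.finrank_add_finrank_orthogonal' W
  rw [hdisj, finrank_bot, hrange] at hsum
  rw [hker, inf_bot_eq, finrank_bot, horth] at htot
  simp only [Module.finrank_fintype_fun_eq_card, Fintype.card_sum, Fintype.card_prod,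
    Fintype.card_fin] at htot
  obtain ⟨q, rfl⟩ := Nat.exists_eq_succ_of_ne_zero (NeZero.ne p)
  rw [Nat.succ_sub_one]
  rw [Nat.mul_succ] at htot
  omega

end Averaging

section QuotientRing

open Polynomial

variable {p c f : ℕ}

noncomputable instance (p : ℕ) : Algebra (ZMod 2)[X] (Rp p) :=
  (Ideal.Quotient.mk (Ideal.span {(X : (ZMod 2)[X]) ^ p - 1})).toAlgebra

lemma toRp_eq_algebraMap (q : (ZMod 2)[X]) : toRp p q = algebraMap (ZMod 2)[X] (Rp p) q := rfl

lemma toRp_surjective : Function.Surjective (toRp p) := Ideal.Quotient.mk_surjective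

lemma toRp_eq_zero_iff {q : (ZMod 2)[X]} : toRp p q = 0 ↔ X ^ p - 1 ∣ q :=
  Ideal.Quotient.eq_zero_iff_dvd _ _

lemma smul_toRp (q r : (ZMod 2)[X]) : q • toRp p r = toRp p (q * r) := by
  simp [toRp_eq_algebraMap, Algebra.smul_def]

lemma X_pow_sub_one_monic (hp : p ≠ 0) : (X ^ p - 1 : (ZMod 2)[X]).Monic := by
  simpa using monic_X_pow_sub_C (1 : ZMod 2) hp

lemma mem_Isub_iff (hp : p ≠ 0) {h g : (ZMod 2)[X]} (hg : h * g = X ^ p - 1) {a : Rp p} :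
    a ∈ Isub p g ↔ h • a = 0 := by
  obtain ⟨q, rfl⟩ := toRp_surjective a
  have h0 : h ≠ 0 := by
    rintro rfl
    exact (X_pow_sub_one_monic hp).ne_zero (by rw [← hg, zero_mul])
  rw [Isub, SetLike.mem_coe, Ideal.mem_span_singleton', smul_toRp, toRp_eq_zero_iff, ← hg,
    mul_dvd_mul_iff_left h0]
  constructor
  · rintro ⟨b, hb⟩
    obtain ⟨r, rfl⟩ := toRp_surjective b
    rw [toRp_eq_algebraMap, toRp_eq_algebraMap, toRp_eq_algebraMap, ← map_mul, ← sub_eq_zero,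
      ← map_sub, ← toRp_eq_algebraMap, toRp_eq_zero_iff] at hb
    have := (Dvd.intro_left h hg).trans hb
    rwa [dvd_sub_right (Dvd.intro_left r rfl)] at this
  · rintro ⟨r, rfl⟩
    exact ⟨toRp p r, by simp [toRp_eq_algebraMap, mul_comm]⟩

/-- The polynomial of degree less than `p` given by the values of `v` on the `b`-th cycle. -/
noncomputable def cyclePoly (v : Idx p c f → ZMod 2) (b : Fin c) : (ZMod 2)[X] :=
  ∑ r : Fin p, C (v (Sum.inl (b, r))) * X ^ (r : ℕ)

lemma phiCoord_eq (v : Idx p c f → ZMod 2) (b : Fin c) :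
    phiCoord p c f v b = toRp p (cyclePoly v b) := rfl

lemma cyclePoly_add (v w : Idx p c f → ZMod 2) (b : Fin c) :
    cyclePoly (v + w) b = cyclePoly v b + cyclePoly w b := by
  simp [cyclePoly, add_mul, Finset.sum_add_distrib]

lemma cyclePoly_smul (a : ZMod 2) (v : Idx p c f → ZMod 2) (b : Fin c) :
    cyclePoly (a • v) b = C a * cyclePoly v b := by
  simp [cyclePoly, Finset.mul_sum, mul_assoc]

lemma coeff_cyclePoly (v : Idx p c f → ZMod 2) (b : Fin c) (r : Fin p) :
    (cyclePoly v b).coeff r = v (Sum.inl (b, r)) := by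
  simp [cyclePoly, coeff_C_mul, coeff_X_pow, Fin.val_inj]

lemma degree_cyclePoly_lt (v : Idx p c f → ZMod 2) (b : Fin c) :
    (cyclePoly v b).degree < p := by
  refine (degree_sum_le _ _).trans_lt ?_
  rw [Finset.sup_lt_iff (by exact WithBot.bot_lt_coe p)]
  intro r _
  exact (degree_C_mul_X_pow_le _ _).trans_lt (by exact_mod_cast r.2)

lemma X_sub_one_dvd_cyclePoly {v : Idx p c f → ZMod 2} {b : Fin c}
    (hv : ∑ r, v (Sum.inl (b, r)) = 0) : X - 1 ∣ cyclePoly v b := by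
  rw [← C_1, dvd_iff_isRoot]
  simpa [cyclePoly, eval_finsetSum] using hv

lemma eq_zero_of_phiCoord_eq_zero (hp : p ≠ 0) {v : Idx p c f → ZMod 2} {b : Fin c}
    (hv : phiCoord p c f v b = 0) (r : Fin p) : v (Sum.inl (b, r)) = 0 := by
  rw [phiCoord_eq, toRp_eq_zero_iff] at hv
  have hdeg : (X ^ p - 1 : (ZMod 2)[X]).degree = p := by
    simpa using degree_X_pow_sub_C (Nat.pos_of_ne_zero hp) (1 : ZMod 2)
  rw [← coeff_cyclePoly v b r,
    eq_zero_of_dvd_of_degree_lt hv (hdeg ▸ degree_cyclePoly_lt v b), coeff_zero]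

lemma toRp_X_pow (n : ℕ) : toRp p (X ^ n) = toRp p (X ^ (n % p)) := by
  have h1 : toRp p X ^ p = 1 := by
    rw [← sub_eq_zero]
    simpa [toRp_eq_algebraMap] using! (toRp_eq_zero_iff (p := p)).2 dvd_rfl
  simpa [toRp_eq_algebraMap] using! pow_eq_pow_mod n h1

lemma X_smul_phiCoord [NeZero p] (v : Idx p c f → ZMod 2) (b : Fin c) :
    (X : (ZMod 2)[X]) • phiCoord p c f v b =
      phiCoord p c f (v ∘ (stdPerm p c f).symm) b := by
  have key (r : Fin p) : toRp p (X * (C (v (Sum.inl (b, r))) * X ^ (r : ℕ))) =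
      toRp p (C (v (Sum.inl (b, r))) * X ^ ((r + 1 : Fin p) : ℕ)) := by
    have hr : ((r + 1 : Fin p) : ℕ) = (r + 1) % p := by simp [Fin.val_add]
    have := toRp_X_pow (p := p) (r + 1)
    rw [← hr] at this
    simp only [toRp_eq_algebraMap, map_mul] at this ⊢
    rw [← this, pow_succ, map_mul]
    ring
  rw [phiCoord_eq, phiCoord_eq, smul_toRp, cyclePoly, cyclePoly, Finset.mul_sum]
  conv_rhs => rw [← Equiv.sum_comp (Equiv.addRight (1 : Fin p))]
  simp only [toRp_eq_algebraMap, map_sum] at key ⊢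
  exact Finset.sum_congr rfl fun r _ => by simpa [stdPerm] using key r

end QuotientRing

section Image

open Polynomial

variable {p c f : ℕ} [NeZero p]

/-- The map `φ` on all of `F_2^n`. -/
noncomputable def phiHom (p c f : ℕ) : (Idx p c f → ZMod 2) →+ (Fin c → Rp p) where
  toFun := phiCoord p c f
  map_zero' := by
    ext b
    simp [phiCoord_eq, cyclePoly, toRp_eq_algebraMap]
  map_add' v w := by
    ext b
    simp [phiCoord_eq, cyclePoly_add, toRp_eq_algebraMap]

lemma mem_CphiSet {Code : Submodule (ZMod 2) (Idx p c f → ZMod 2)} {u : Fin c → Rp p} :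
    u ∈ CphiSet p c f Code ↔ ∃ v ∈ evenSubcode p c f Code, phiHom p c f v = u := by
  simp only [CphiSet, Set.mem_ofPred_eq, funext_iff, eq_comm (a := u _)]
  rfl

lemma X_smul_phiHom (v : Idx p c f → ZMod 2) :
    (X : (ZMod 2)[X]) • phiHom p c f v = phiHom p c f (v ∘ (stdPerm p c f).symm) :=
  funext (X_smul_phiCoord v)

omit [NeZero p] in
lemma C_smul_phiHom (a : ZMod 2) (v : Idx p c f → ZMod 2) :
    (C a : (ZMod 2)[X]) • phiHom p c f v = phiHom p c f (a • v) := by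
  ext b
  change C a • phiCoord p c f v b = phiCoord p c f (a • v) b
  rw [phiCoord_eq, phiCoord_eq, smul_toRp, cyclePoly_smul]

lemma comp_stdPerm_symm_mem_evenSubcode {Code : Submodule (ZMod 2) (Idx p c f → ZMod 2)}
    (haut : permCode (stdPerm p c f) Code = Code) {v : Idx p c f → ZMod 2}
    (hv : v ∈ evenSubcode p c f Code) : v ∘ (stdPerm p c f).symm ∈ evenSubcode p c f Code := by
  rw [mem_evenSubcode] at hv ⊢
  refine ⟨comp_stdPerm_symm_mem haut hv.1, fun b => ?_, fun k => by simpa [stdPerm] using hv.2.2 k⟩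
  rw [← Equiv.sum_comp (Equiv.addRight (1 : Fin p)), ← hv.2.1 b]
  simp [stdPerm]

/-- `C_φ` as a module over `F_2[x]`. -/
noncomputable def cphiSubmodule (Code : Submodule (ZMod 2) (Idx p c f → ZMod 2))
    (haut : permCode (stdPerm p c f) Code = Code) : Submodule (ZMod 2)[X] (Fin c → Rp p) where
  carrier := CphiSet p c f Code
  zero_mem' := mem_CphiSet.2 ⟨0, Submodule.zero_mem _, map_zero _⟩
  add_mem' := by
    simp only [mem_CphiSet]
    rintro _ _ ⟨v, hv, rfl⟩ ⟨w, hw, rfl⟩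
    exact ⟨v + w, Submodule.add_mem _ hv hw, map_add _ _ _⟩
  smul_mem' q u hu := by
    simp only [mem_CphiSet] at hu ⊢
    obtain ⟨v, hv, rfl⟩ := hu
    induction q using Polynomial.induction_on' generalizing v with
    | add q r hq hr =>
      obtain ⟨v₁, hv₁, h₁⟩ := hq v hv
      obtain ⟨v₂, hv₂, h₂⟩ := hr v hv
      exact ⟨v₁ + v₂, Submodule.add_mem _ hv₁ hv₂, by rw [map_add, h₁, h₂, add_smul]⟩
    | monomial n a =>
      induction n generalizing v with
      | zero => exact ⟨a • v, Submodule.smul_mem _ _ hv, by simp [← C_smul_phiHom]⟩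
      | succ n ih =>
        obtain ⟨w, hw, h⟩ := ih _ (comp_stdPerm_symm_mem_evenSubcode haut hv)
        exact ⟨w, hw, by rw [h, ← X_smul_phiHom, smul_smul, monomial_mul_X]⟩

variable {Code : Submodule (ZMod 2) (Idx p c f → ZMod 2)}

lemma mem_cphiSubmodule (haut : permCode (stdPerm p c f) Code = Code) {u : Fin c → Rp p} :
    u ∈ cphiSubmodule Code haut ↔ u ∈ CphiSet p c f Code := Iff.rfl

lemma card_cphiSubmodule (haut : permCode (stdPerm p c f) Code = Code) :
    Nat.card (cphiSubmodule Code haut) =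
      2 ^ Module.finrank (ZMod 2) (evenSubcode p c f Code) := by
  have himage : (cphiSubmodule Code haut : Set (Fin c → Rp p)) =
      phiHom p c f '' (evenSubcode p c f Code) := by
    ext u
    exact mem_CphiSet
  have hinj : Set.InjOn (phiHom p c f) (evenSubcode p c f Code) := by
    intro v hv w hw hvw
    rw [← sub_eq_zero, ← map_sub] at hvw
    have hmem := (mem_evenSubcode.1 (Submodule.sub_mem _ hv hw)).2.2
    rw [← sub_eq_zero]
    ext (⟨b, r⟩ | k)
    · exact eq_zero_of_phiCoord_eq_zero (NeZero.ne p) (congrFun hvw b) r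
    · exact hmem k
  rw [← SetLike.coe_sort_coe, himage, Nat.card_image_of_injOn hinj, SetLike.coe_sort_coe,
    Module.natCard_eq_pow_finrank (K := ZMod 2), Nat.card_zmod]

lemma smul_eq_zero_of_mem_cphiSubmodule (haut : permCode (stdPerm p c f) Code = Code)
    {q : (ZMod 2)[X]} (hq : X ^ p - 1 = (X - 1) * q) {u : Fin c → Rp p}
    (hu : u ∈ cphiSubmodule Code haut) : q • u = 0 := by
  obtain ⟨v, hv, rfl⟩ := mem_CphiSet.1 hu
  ext b
  change q • phiCoord p c f v b = 0
  rw [phiCoord_eq, smul_toRp, toRp_eq_zero_iff, hq, mul_comm q]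
  exact mul_dvd_mul_right (X_sub_one_dvd_cyclePoly ((mem_evenSubcode.1 hv).2.1 b)) q

end Image

section Torsion

open scoped Function

variable {R M : Type*} [CommRing R] [AddCommGroup M] [Module R M]

lemma existsUnique_sum_of_prod_smul_eq_zero {s : ℕ} {h : Fin s → R}
    (hcop : Pairwise (IsCoprime on h)) (N : Submodule R M) {u : M} (hu : u ∈ N)
    (hprod : (∏ j, h j) • u = 0) :
    ∃! m : Fin s → M, (∀ j, m j ∈ N ∧ h j • m j = 0) ∧ u = ∑ j, m j := by
  classical
  rcases isEmpty_or_nonempty (Fin s) with hs | hs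
  · refine ⟨0, ⟨fun j => isEmptyElim j, ?_⟩, fun m _ => Subsingleton.elim _ _⟩
    simpa using hprod
  obtain ⟨μ, hμ⟩ := exists_sum_eq_one_iff_pairwise_coprime'.2 hcop
  have hmul (j : Fin s) : h j * ∏ i ∈ {j}ᶜ, h i = ∏ i, h i :=
    (Fintype.prod_eq_mul_prod_compl j h).symm
  refine ⟨fun j => (μ j * ∏ i ∈ {j}ᶜ, h i) • u, ⟨fun j => ⟨N.smul_mem _ hu, ?_⟩, ?_⟩, ?_⟩
  · rw [smul_smul, mul_left_comm, hmul, mul_smul, hprod, smul_zero]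
  · rw [← Finset.sum_smul, hμ, one_smul]
  · rintro m ⟨hm, rfl⟩
    have hkill {i j : Fin s} (hij : i ≠ j) : (μ i * ∏ k ∈ {i}ᶜ, h k) • m j = 0 := by
      obtain ⟨q, hq⟩ : h j ∣ ∏ k ∈ {i}ᶜ, h k :=
        Finset.dvd_prod_of_mem h (by simpa using hij.symm)
      rw [hq, mul_left_comm, mul_comm, mul_smul, (hm j).2, smul_zero]
    ext j
    rw [Finset.smul_sum, Finset.sum_eq_single j (fun i _ hi => hkill hi.symm) (by simp)]
    conv_lhs => rw [← one_smul R (m j), ← hμ, Finset.sum_smul]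
    exact Finset.sum_eq_single j (fun i _ hi => hkill hi) (by simp)

lemma natCard_quotient_span {K : Type*} [Field K] [Finite K] {q : Polynomial K} (hq : q ≠ 0) :
    Nat.card (Polynomial K ⧸ Ideal.span {q}) = Nat.card K ^ q.natDegree := by
  have : Module.Finite K (Polynomial K ⧸ Ideal.span {q}) := (AdjoinRoot.powerBasis hq).finite
  rw [Module.natCard_eq_pow_finrank (K := K), finrank_quotient_span_eq_natDegree]

lemma exists_natCard_torsionBy_eq_pow {K V : Type*} [Field K] [Finite K] [AddCommGroup V]
    [Module (Polynomial K) V] [Finite V] {q : Polynomial K} (hq : Irreducible q) :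
    ∃ d : ℕ, Nat.card (Submodule.torsionBy (Polynomial K) V q) =
      (Nat.card K ^ q.natDegree) ^ d := by
  have : (Ideal.span {q}).IsMaximal := PrincipalIdealRing.isMaximal_of_irreducible hq
  let := Ideal.Quotient.field (Ideal.span {q})
  refine ⟨Module.finrank (Polynomial K ⧸ Ideal.span {q})
    (Submodule.torsionBy (Polynomial K) V q), ?_⟩
  rw [← natCard_quotient_span hq.ne_zero]
  exact Module.natCard_eq_pow_finrank

end Torsion

section Factors

open Polynomial
open scoped Function

variable {p s : ℕ} {h : Fin s → (ZMod 2)[X]}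

lemma pairwise_isCoprime_of_X_pow_sub_one (hodd : Odd p)
    (hfact : (X ^ p - 1 : (ZMod 2)[X]) = (X - 1) * ∏ j : Fin s, h j) :
    Pairwise (IsCoprime on h) := by
  intro i j hij
  have hsep : (X ^ p - 1 : (ZMod 2)[X]).Separable := by
    have h1 : (p : ZMod 2) = 1 := (ZMod.natCast_eq_one_iff_odd).2 hodd
    simpa using separable_X_pow_sub_C (1 : ZMod 2) (n := p) (by simp [h1]) one_ne_zero
  refine (hsep.of_dvd ?_).isCoprime
  rw [hfact, ← Finset.mul_prod_erase _ h (Finset.mem_univ i)]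
  exact Dvd.dvd.mul_left
    (mul_dvd_mul_left _ (Finset.dvd_prod_of_mem h (by simpa using hij.symm))) _

lemma exists_natDegree_eq (hp : p.Prime) (hodd : Odd p) (hirr : ∀ j, Irreducible (h j))
    (hfact : (X ^ p - 1 : (ZMod 2)[X]) = (X - 1) * ∏ j : Fin s, h j) :
    ∃ m : ℕ, (∀ j, (h j).natDegree = m) ∧ s * m = p - 1 := by
  have := Fact.mk hp
  have hcyc : ∏ j, h j = cyclotomic p (ZMod 2) := by
    have hne : (X - 1 : (ZMod 2)[X]) ≠ 0 := by simpa using X_sub_C_ne_zero (1 : ZMod 2)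
    refine mul_left_cancel₀ hne ?_
    rw [← hfact, mul_comm, cyclotomic_prime_mul_X_sub_one]
  have hcop : Nat.Coprime 2 p := Nat.coprime_two_left.2 hodd
  have hdeg (j : Fin s) := natDegree_of_dvd_cyclotomic_of_irreducible (f := 1) (ZMod.card 2) hcop
    (hcyc ▸ Finset.dvd_prod_of_mem h (Finset.mem_univ j)) (hirr j)
  refine ⟨_, hdeg, ?_⟩
  have hsum := natDegree_prod Finset.univ h fun j _ => (hirr j).ne_zero
  rw [hcyc, natDegree_cyclotomic, Nat.totient_prime hp] at hsum
  simp [hsum, hdeg]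

end Factors

section Components

open Polynomial

variable {p c f : ℕ} [NeZero p] {Code : Submodule (ZMod 2) (Idx p c f → ZMod 2)}

lemma mem_Msub_iff (haut : permCode (stdPerm p c f) Code = Code) {h g : (ZMod 2)[X]}
    (hg : h * g = X ^ p - 1) {u : Fin c → Rp p} :
    u ∈ Msub p c f Code g ↔ u ∈ cphiSubmodule Code haut ∧ h • u = 0 := by
  simp only [Msub, Set.mem_ofPred_eq, mem_cphiSubmodule, mem_Isub_iff (NeZero.ne p) hg,
    funext_iff, Pi.smul_apply, Pi.zero_apply]

lemma finite_cphiSubmodule (haut : permCode (stdPerm p c f) Code = Code) :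
    Finite (cphiSubmodule Code haut) :=
  Nat.finite_of_card_ne_zero (by simp [card_cphiSubmodule])

lemma exists_natCard_Msub_eq_pow (haut : permCode (stdPerm p c f) Code = Code)
    {h g : (ZMod 2)[X]} (hirr : Irreducible h) (hg : h * g = X ^ p - 1) :
    ∃ d : ℕ, Nat.card (Msub p c f Code g) = (2 ^ h.natDegree) ^ d := by
  have := finite_cphiSubmodule haut
  obtain ⟨d, hd⟩ := exists_natCard_torsionBy_eq_pow (V := cphiSubmodule Code haut) hirr
  refine ⟨d, ?_⟩
  rw [Nat.card_zmod] at hd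
  rw [← hd]
  refine Nat.card_congr
    { toFun := fun u => ⟨⟨u, ((mem_Msub_iff haut hg).1 u.2).1⟩, ?_⟩
      invFun := fun u => ⟨u, (mem_Msub_iff haut hg).2 ⟨u.1.2, congrArg Subtype.val u.2⟩⟩
      left_inv := fun _ => rfl
      right_inv := fun _ => rfl }
  exact Subtype.ext ((mem_Msub_iff haut hg).1 u.2).2

lemma natCard_cphiSubmodule_eq_prod (haut : permCode (stdPerm p c f) Code = Code) {s : ℕ}
    {g : Fin s → (ZMod 2)[X]}
    (hdec : ∀ u ∈ CphiSet p c f Code, ∃! m : Fin s → Fin c → Rp p,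
      (∀ j, m j ∈ Msub p c f Code (g j)) ∧ u = ∑ j, m j) :
    Nat.card (cphiSubmodule Code haut) = ∏ j, Nat.card (Msub p c f Code (g j)) := by
  rw [← Nat.card_pi]
  symm
  have hmem (m : ∀ j, Msub p c f Code (g j)) :
      ∑ j, (m j : Fin c → Rp p) ∈ cphiSubmodule Code haut :=
    Submodule.sum_mem _ fun j _ => (m j).2.1
  refine Nat.card_eq_of_bijective (fun m => ⟨∑ j, (m j : Fin c → Rp p), hmem m⟩) ⟨?_, ?_⟩
  · intro m m' hmm
    have := (hdec _ (hmem m)).unique ⟨fun j => (m j).2, rfl⟩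
      ⟨fun j => (m' j).2, congrArg Subtype.val hmm⟩
    ext j : 2
    exact congrFun this j
  · rintro ⟨u, hu⟩
    obtain ⟨m, ⟨hm, rfl⟩, -⟩ := hdec u hu
    exact ⟨fun j => ⟨m j, hm j⟩, rfl⟩

end Components

/-- Decomposition of `C_φ`: writing `x^p - 1 = (x-1)h₁⋯h_s` with the `h_j` distinct
irreducible binary polynomials and `g_j = (x^p-1)/h_j`, the sets
`M_j = {u ∈ C_φ : u_i ∈ I_j = ⟨g_j⟩}` satisfy:
(1) each `M_j` is a linear space over the field `I_j` (it contains `0` and is closed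
under addition and under multiplication by scalars from `I_j`);
(2) `C_φ = M₁ ⊕ ⋯ ⊕ M_s` (every element of `C_φ` is uniquely a sum of elements of the `M_j`);
(3) if `C` is self-dual then `∑ dim_{I_j} M_j = cs/2`, expressed via cardinalities:
there are `d_j` with `|M_j| = (2^{deg h_j})^{d_j}` and `2·∑ d_j = c·s`. -/
theorem cphi_module_decomposition (p c f s : ℕ) [NeZero p] (hp : p.Prime) (hodd : Odd p)
    (Code : Submodule (ZMod 2) (Idx p c f → ZMod 2))
    (haut : permCode (stdPerm p c f) Code = Code)
    (h g : Fin s → Polynomial (ZMod 2))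
    (hirr : ∀ j, Irreducible (h j))
    (hdist : Function.Injective h)
    (hfact : (Polynomial.X ^ p - 1 : Polynomial (ZMod 2)) =
      (Polynomial.X - 1) * ∏ j : Fin s, h j)
    (hg : ∀ j, h j * g j = Polynomial.X ^ p - 1) :
    (∀ j : Fin s,
      (0 : Fin c → Rp p) ∈ Msub p c f Code (g j) ∧
      (∀ u ∈ Msub p c f Code (g j), ∀ v ∈ Msub p c f Code (g j),
        u + v ∈ Msub p c f Code (g j)) ∧
      (∀ a ∈ Isub p (g j), ∀ u ∈ Msub p c f Code (g j),
        (fun i => a * u i) ∈ Msub p c f Code (g j))) ∧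
    (∀ u ∈ CphiSet p c f Code,
      ∃! m : Fin s → Fin c → Rp p,
        (∀ j, m j ∈ Msub p c f Code (g j)) ∧ u = ∑ j : Fin s, m j) ∧
    (isSelfDual Code →
      ∃ d : Fin s → ℕ,
        (∀ j, Nat.card (Msub p c f Code (g j)) = (2 ^ (h j).natDegree) ^ d j) ∧
        2 * ∑ j : Fin s, d j = c * s) := by
  have hMsub (j : Fin s) {u : Fin c → Rp p} := mem_Msub_iff haut (hg j) (u := u)
  have hdec : ∀ u ∈ CphiSet p c f Code,
      ∃! m : Fin s → Fin c → Rp p,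
        (∀ j, m j ∈ Msub p c f Code (g j)) ∧ u = ∑ j : Fin s, m j := by
    intro u hu
    simp only [hMsub]
    exact existsUnique_sum_of_prod_smul_eq_zero (pairwise_isCoprime_of_X_pow_sub_one hodd hfact)
      _ hu (smul_eq_zero_of_mem_cphiSubmodule haut hfact hu)
  refine ⟨fun j => ⟨?_, fun u hu v hv => ?_, fun a _ u hu => ?_⟩, hdec, fun hsd => ?_⟩
  · exact (hMsub j).2 ⟨Submodule.zero_mem _, smul_zero _⟩
  · rw [hMsub] at hu hv ⊢
    exact ⟨Submodule.add_mem _ hu.1 hv.1, by rw [smul_add, hu.2, hv.2, add_zero]⟩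
  · obtain ⟨q, rfl⟩ := toRp_surjective a
    rw [hMsub] at hu
    have hq : (fun i => toRp p q * u i) = q • u :=
      funext fun i => (Algebra.smul_def q (u i)).symm
    rw [hq, hMsub]
    exact ⟨Submodule.smul_mem _ _ hu.1, by rw [smul_comm, hu.2, smul_zero]⟩
  · choose d hd using fun j => exists_natCard_Msub_eq_pow haut (hirr j) (hg j)
    refine ⟨d, hd, ?_⟩
    obtain ⟨m, hm, hsm⟩ := exists_natDegree_eq hp hodd hirr hfact
    have hcard := natCard_cphiSubmodule_eq_prod haut hdec
    simp only [card_cphiSubmodule, hd, hm, ← pow_mul, Finset.prod_pow_eq_pow_sum,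
      ← Finset.mul_sum] at hcard
    have hrank := two_mul_finrank_evenSubcode hodd haut hsd
    rw [Nat.pow_right_injective le_rfl hcard, ← hsm] at hrank
    have hm0 : 0 < m := by
      have := hp.two_le
      refine Nat.pos_of_ne_zero fun h0 => ?_
      rw [h0, mul_zero] at hsm
      omega
    refine Nat.eq_of_mul_eq_mul_left hm0 ?_
    linarith

end SD
end
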